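/- The Kalman-like estimation strategy g* is part of a globally optimal pair: the infimum over transmission strategies f of J(f, g*) equals the infimum over all pairs (f, g) of J(f, g). -/

import Mathlib

open scoped ENNReal

noncomputable section

abbrev Euc (n : ℕ) := EuclideanSpace ℝ (Fin n)

variable {n : ℕ}

/-- Source trajectory: `X_1 = n_1`, `X_{t+1} = λ A X_t + n_{t+1}` (0-indexed). -/
def srcX (lam : ℝ) (A : Euc n ≃ₗᵢ[ℝ] Euc n) (ν : ℕ → Euc n) : ℕ → Euc n
  | 0 => ν 0
  | t + 1 => lam • A (srcX lam A ν t) + ν (t + 1)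

/-- Admissible noise sequences: `‖n_t‖ ≤ a_t` throughout the horizon. -/
def Noise (n : ℕ) (T : ℕ) (a : ℕ → ℝ) : Set (ℕ → Euc n) := {ν | ∀ t < T, ‖ν t‖ ≤ a t}

/-- A transmission strategy, encoded by the transmission decisions it induces on
noise realizations.  `adapted` says the decision at time `t` is a function of the
information `(X_{1:t}, E_{1:t}, Y_{1:t-1})` available to the sensor (equivalently,
since the energy levels and channel outputs are themselves determined by `X_{1:t}`
and the strategy, a function of `X_{1:t}`); `energy_ok` says a transmission can
occur only when the remaining energy `E_t = K − Σ_{i<t} U_i` is positive. -/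
structure TxStrategy (lam : ℝ) (A : Euc n ≃ₗᵢ[ℝ] Euc n) (T K : ℕ) where
  U : (ℕ → Euc n) → ℕ → Bool
  energy_ok : ∀ ν t, t < T → U ν t = true →
    (∑ i ∈ Finset.range t, (if U ν i then 1 else 0)) < K
  adapted : ∀ ν ν' t, t < T →
    (∀ i ≤ t, srcX lam A ν i = srcX lam A ν' i) → U ν t = U ν' t

/-- Channel output: `Y_t = X_t` if `U_t = 1`, and `Y_t = ε` (i.e. `none`) otherwise. -/
def chOut (lam : ℝ) (A : Euc n ≃ₗᵢ[ℝ] Euc n) (U : (ℕ → Euc n) → ℕ → Bool)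
    (ν : ℕ → Euc n) (t : ℕ) : Option (Euc n) :=
  if U ν t then some (srcX lam A ν t) else none

/-- An estimation strategy: `X̂_t = g_t(Y_{1:t})`. -/
def EstStrategy (n : ℕ) : Type := (t : ℕ) → (Fin (t + 1) → Option (Euc n)) → Euc n

/-- Worst-case maximum instantaneous estimation error
`J(f, g) = sup_{noise} max_{1≤t≤T} ‖X_t − X̂_t‖` (valued in `ℝ≥0∞`). -/
def Jcost (lam : ℝ) (A : Euc n ≃ₗᵢ[ℝ] Euc n) (T K : ℕ) (a : ℕ → ℝ)
    (f : TxStrategy lam A T K) (g : EstStrategy n) : ℝ≥0∞ :=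
  ⨆ ν ∈ Noise n T a, ⨆ t : Fin T,
    ENNReal.ofReal ‖srcX lam A ν t - g t (fun i => chOut lam A f.U ν i)‖


/-- The Kalman-like estimation strategy `g*`: `X̃_0 = 0`, `X̃_t = y_t` if `y_t ≠ ε`
and `X̃_t = λ A X̃_{t−1}` if `y_t = ε`; `g*_t(y_{1:t}) = X̃_t`. -/
def gstar {n : ℕ} (lam : ℝ) (A : Euc n ≃ₗᵢ[ℝ] Euc n) : EstStrategy n := fun _ ys =>
  (List.ofFn ys).foldl (fun acc y => Option.elim y (lam • A acc) (fun x => x)) 0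

/-- The worst-case error budget: the first component accumulates the largest possible
prediction error, and is reset to `0` (increasing the counter) each time it exceeds `c`. -/
def worstRun (lam c : ℝ) (a : ℕ → ℝ) : ℕ → ℝ × ℕ
  | 0 => (0, 0)
  | t + 1 =>
    let p := worstRun lam c a t
    if c < |lam| * p.1 + a t then (0, p.2 + 1) else (|lam| * p.1 + a t, p.2)

/-- State of the Kalman-like estimator fed by the threshold rule with energy budget `K`:
the estimate after the first `t` steps, and the number of transmissions so far. -/
def thresholdRun (lam : ℝ) (A : Euc n ≃ₗᵢ[ℝ] Euc n) (K : ℕ) (c : ℝ) (x : ℕ → Euc n) :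
    ℕ → Euc n × ℕ
  | 0 => (0, 0)
  | t + 1 =>
    let p := thresholdRun lam A K c x t
    if p.2 < K ∧ c < ‖x t - lam • A p.1‖ then (x t, p.2 + 1) else (lam • A p.1, p.2)

open Classical in
/-- Transmission decisions of the threshold rule. -/
def thresholdDecision (lam : ℝ) (A : Euc n ≃ₗᵢ[ℝ] Euc n) (K : ℕ) (c : ℝ) (x : ℕ → Euc n)
    (t : ℕ) : Bool :=
  decide ((thresholdRun lam A K c x t).2 < K ∧
    c < ‖x t - lam • A (thresholdRun lam A K c x t).1‖)

lemma thresholdRun_succ (lam : ℝ) (A : Euc n ≃ₗᵢ[ℝ] Euc n) (K : ℕ) (c : ℝ) (x : ℕ → Euc n)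
    (t : ℕ) : thresholdRun lam A K c x (t + 1) =
      if thresholdDecision lam A K c x t then (x t, (thresholdRun lam A K c x t).2 + 1)
      else (lam • A (thresholdRun lam A K c x t).1, (thresholdRun lam A K c x t).2) := by
  simp [thresholdRun, thresholdDecision]

lemma thresholdRun_congr (lam : ℝ) (A : Euc n ≃ₗᵢ[ℝ] Euc n) (K : ℕ) (c : ℝ)
    {x y : ℕ → Euc n} {t : ℕ} (h : ∀ i < t, x i = y i) :
    thresholdRun lam A K c x t = thresholdRun lam A K c y t := by
  induction t with
  | zero => rfl
  | succ t ih =>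
    simp only [thresholdRun, ih fun i hi => h i (by omega), h t (by omega)]

lemma thresholdRun_snd (lam : ℝ) (A : Euc n ≃ₗᵢ[ℝ] Euc n) (K : ℕ) (c : ℝ) (x : ℕ → Euc n)
    (t : ℕ) : (thresholdRun lam A K c x t).2 =
      ∑ i ∈ Finset.range t, if thresholdDecision lam A K c x i then 1 else 0 := by
  induction t with
  | zero => rfl
  | succ t ih =>
    rw [Finset.sum_range_succ, ← ih, thresholdRun_succ]
    split_ifs <;> rfl

/-- The threshold rule as a transmission strategy. -/
def thresholdStrategy (lam : ℝ) (A : Euc n ≃ₗᵢ[ℝ] Euc n) (T K : ℕ) (c : ℝ) :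
    TxStrategy lam A T K where
  U ν := thresholdDecision lam A K c (srcX lam A ν)
  energy_ok ν t _ h := by
    rw [← thresholdRun_snd]
    simp only [thresholdDecision, decide_eq_true_eq] at h
    exact h.1
  adapted ν ν' t _ h := by
    simp only [thresholdDecision, h t le_rfl,
      thresholdRun_congr lam A K c (t := t) fun i hi => h i hi.le]

lemma foldl_chOut_thresholdStrategy (lam : ℝ) (A : Euc n ≃ₗᵢ[ℝ] Euc n) (T K : ℕ) (c : ℝ)
    (ν : ℕ → Euc n) (t : ℕ) :
    (List.ofFn fun i : Fin t => chOut lam A (thresholdStrategy lam A T K c).U ν i).foldl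
      (fun acc y => Option.elim y (lam • A acc) (fun x => x)) 0 =
      (thresholdRun lam A K c (srcX lam A ν) t).1 := by
  induction t with
  | zero => rfl
  | succ t ih =>
    rw [List.ofFn_succ', List.concat_eq_append, List.foldl_append]
    simp only [Fin.val_castSucc, ih, Fin.val_last, List.foldl_cons, List.foldl_nil,
      thresholdRun_succ]
    simp only [chOut, thresholdStrategy]
    split_ifs with h <;> simp [h]

lemma worstRun_fst_nonneg {lam c : ℝ} {a : ℕ → ℝ} (ha : ∀ t, 0 ≤ a t) (t : ℕ) :
    0 ≤ (worstRun lam c a t).1 := by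
  induction t with
  | zero => exact le_rfl
  | succ t ih =>
    have := ha t
    simp only [worstRun]
    split_ifs
    · exact le_rfl
    · positivity

lemma worstRun_snd_mono (lam c : ℝ) (a : ℕ → ℝ) :
    Monotone fun t => (worstRun lam c a t).2 := by
  refine monotone_nat_of_le_succ fun t => ?_
  simp only [worstRun]
  split_ifs <;> simp

/-- The one-step prediction of the source from its own past. -/
def predX (lam : ℝ) (A : Euc n ≃ₗᵢ[ℝ] Euc n) (ν : ℕ → Euc n) : ℕ → Euc n
  | 0 => 0
  | t + 1 => lam • A (srcX lam A ν t)

lemma srcX_eq_predX_add (lam : ℝ) (A : Euc n ≃ₗᵢ[ℝ] Euc n) (ν : ℕ → Euc n) (t : ℕ) :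
    srcX lam A ν t = predX lam A ν t + ν t := by
  cases t <;> simp [srcX, predX]

lemma srcX_congr (lam : ℝ) (A : Euc n ≃ₗᵢ[ℝ] Euc n) {ν ν' : ℕ → Euc n} {t : ℕ}
    (h : ∀ i ≤ t, ν i = ν' i) : srcX lam A ν t = srcX lam A ν' t := by
  induction t with
  | zero => exact h 0 le_rfl
  | succ t ih => simp only [srcX, ih fun i hi => h i (by omega), h (t + 1) le_rfl]

/-- The threshold run is dominated, lexicographically, by the worst-case run. -/
def IsDominatedAt (lam : ℝ) (A : Euc n ≃ₗᵢ[ℝ] Euc n) (K : ℕ) (c : ℝ) (a : ℕ → ℝ)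
    (ν : ℕ → Euc n) (t : ℕ) : Prop :=
  (thresholdRun lam A K c (srcX lam A ν) t).2 < (worstRun lam c a t).2 ∨
    (thresholdRun lam A K c (srcX lam A ν) t).2 = (worstRun lam c a t).2 ∧
      ‖predX lam A ν t - lam • A (thresholdRun lam A K c (srcX lam A ν) t).1‖ ≤
        |lam| * (worstRun lam c a t).1

lemma norm_innovation_le {lam : ℝ} {A : Euc n ≃ₗᵢ[ℝ] Euc n} {T : ℕ} {a : ℕ → ℝ}
    {ν : ℕ → Euc n} (hν : ν ∈ Noise n T a) {t : ℕ} (ht : t < T) {z : Euc n} {w : ℝ}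
    (h : ‖predX lam A ν t - z‖ ≤ w) : ‖srcX lam A ν t - z‖ ≤ w + a t := by
  rw [srcX_eq_predX_add, add_sub_right_comm]
  exact (norm_add_le _ _).trans (add_le_add h (hν t ht))

lemma IsDominatedAt.transmit_or_le {lam : ℝ} {A : Euc n ≃ₗᵢ[ℝ] Euc n} {T K : ℕ} {c : ℝ}
    {a : ℕ → ℝ} {ν : ℕ → Euc n} (hν : ν ∈ Noise n T a) (hm : (worstRun lam c a T).2 ≤ K)
    {t : ℕ} (ht : t < T) (h : IsDominatedAt lam A K c a ν t) :
    thresholdDecision lam A K c (srcX lam A ν) t = true ∨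
      ‖srcX lam A ν t - lam • A (thresholdRun lam A K c (srcX lam A ν) t).1‖ ≤ c := by
  by_contra! hcon
  obtain ⟨hd, he⟩ := hcon
  have hK : K ≤ (thresholdRun lam A K c (srcX lam A ν) t).2 := by
    by_contra! hlt
    exact hd (by simp [thresholdDecision, hlt, he])
  have h1 : (worstRun lam c a (t + 1)).2 ≤ (worstRun lam c a T).2 :=
    worstRun_snd_mono lam c a (Nat.succ_le_of_lt ht)
  have h2 : (worstRun lam c a t).2 ≤ (worstRun lam c a (t + 1)).2 :=
    worstRun_snd_mono lam c a (Nat.le_succ t)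
  rcases h with h | ⟨heq, hle⟩
  · omega
  · have hc := he.trans_le (norm_innovation_le hν ht hle)
    simp only [worstRun, if_pos hc] at h1
    omega

lemma isDominatedAt {lam : ℝ} {A : Euc n ≃ₗᵢ[ℝ] Euc n} {T K : ℕ} {c : ℝ}
    {a : ℕ → ℝ} (ha : ∀ t, 0 ≤ a t) {ν : ℕ → Euc n} (hν : ν ∈ Noise n T a)
    (hm : (worstRun lam c a T).2 ≤ K) {t : ℕ} (ht : t ≤ T) :
    IsDominatedAt lam A K c a ν t := by
  induction t with
  | zero => exact Or.inr ⟨rfl, by simp [predX, thresholdRun, worstRun]⟩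
  | succ t ih =>
    have hdom := ih (by omega)
    have htx := hdom.transmit_or_le hν hm ht
    have hw : 0 ≤ |lam| * (worstRun lam c a (t + 1)).1 :=
      mul_nonneg (abs_nonneg _) (worstRun_fst_nonneg ha _)
    by_cases hd : thresholdDecision lam A K c (srcX lam A ν) t = true
    · have hgt : c < ‖srcX lam A ν t -
          lam • A (thresholdRun lam A K c (srcX lam A ν) t).1‖ := by
        simp only [thresholdDecision, decide_eq_true_eq] at hd
        exact hd.2
      have hz : ‖predX lam A ν (t + 1) -
          lam • A (thresholdRun lam A K c (srcX lam A ν) (t + 1)).1‖ ≤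
          |lam| * (worstRun lam c a (t + 1)).1 := by
        simpa [thresholdRun_succ, hd, predX] using hw
      have hs : (thresholdRun lam A K c (srcX lam A ν) (t + 1)).2 =
          (thresholdRun lam A K c (srcX lam A ν) t).2 + 1 := by
        simp [thresholdRun_succ, hd]
      have hle : (thresholdRun lam A K c (srcX lam A ν) (t + 1)).2 ≤
          (worstRun lam c a (t + 1)).2 := by
        rw [hs]
        rcases hdom with h | ⟨heq, hle⟩
        · exact (Nat.succ_le_of_lt h).trans (worstRun_snd_mono lam c a (Nat.le_succ t))
        · have hc := hgt.trans_le (norm_innovation_le hν ht hle)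
          simp only [worstRun, if_pos hc, heq, le_refl]
      rcases hle.lt_or_eq with h | h
      · exact Or.inl h
      · exact Or.inr ⟨h, hz⟩
    · have hs : (thresholdRun lam A K c (srcX lam A ν) (t + 1)).2 =
          (thresholdRun lam A K c (srcX lam A ν) t).2 := by
        simp [thresholdRun_succ, hd]
      have he : predX lam A ν (t + 1) -
          lam • A (thresholdRun lam A K c (srcX lam A ν) (t + 1)).1 =
          lam • A (srcX lam A ν t -
            lam • A (thresholdRun lam A K c (srcX lam A ν) t).1) := by
        simp [thresholdRun_succ, hd, predX, smul_sub]
      unfold IsDominatedAt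
      rw [hs, he, norm_smul, LinearIsometryEquiv.norm_map, Real.norm_eq_abs]
      rcases hdom with h | ⟨heq, hle⟩
      · exact Or.inl (h.trans_le (worstRun_snd_mono lam c a (Nat.le_succ t)))
      · have hb := norm_innovation_le hν ht hle
        simp only [worstRun]
        split_ifs with hc
        · exact Or.inl (by simp [heq])
        · exact Or.inr ⟨heq, mul_le_mul_of_nonneg_left hb (abs_nonneg _)⟩

lemma Jcost_thresholdStrategy_le {lam : ℝ} {A : Euc n ≃ₗᵢ[ℝ] Euc n} {T K : ℕ} {c : ℝ}
    {a : ℕ → ℝ} (ha : ∀ t, 0 ≤ a t) (hc : 0 ≤ c) (hm : (worstRun lam c a T).2 ≤ K) :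
    Jcost lam A T K a (thresholdStrategy lam A T K c) (gstar lam A) ≤ ENNReal.ofReal c := by
  refine iSup₂_le fun ν hν => iSup_le fun t => ENNReal.ofReal_le_ofReal ?_
  have htx := (isDominatedAt (A := A) ha hν hm t.2.le).transmit_or_le hν hm t.2
  have hg : gstar lam A t
      (fun i => chOut lam A (thresholdStrategy lam A T K c).U ν i) =
      (thresholdRun lam A K c (srcX lam A ν) (t + 1)).1 :=
    foldl_chOut_thresholdStrategy lam A T K c ν (t + 1)
  rw [hg, thresholdRun_succ]
  split_ifs with hd
  · simpa using hc
  · exact htx.resolve_left hd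

/-- Unit directions aligned along the source dynamics, starting from `u`. -/
def alignedDir (lam : ℝ) (A : Euc n ≃ₗᵢ[ℝ] Euc n) (u : Euc n) : ℕ → Euc n
  | 0 => u
  | t + 1 => (if 0 ≤ lam then (1 : ℝ) else -1) • A (alignedDir lam A u t)

lemma smul_map_alignedDir (lam : ℝ) (A : Euc n ≃ₗᵢ[ℝ] Euc n) (u : Euc n) (t : ℕ) :
    lam • A (alignedDir lam A u t) = |lam| • alignedDir lam A u (t + 1) := by
  rw [alignedDir, smul_smul]
  split_ifs with h
  · rw [abs_of_nonneg h, mul_one]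
  · rw [abs_of_neg (not_le.mp h), neg_mul_neg, mul_one]

lemma norm_alignedDir (lam : ℝ) (A : Euc n ≃ₗᵢ[ℝ] Euc n) (u : Euc n) (t : ℕ) :
    ‖alignedDir lam A u t‖ = ‖u‖ := by
  induction t with
  | zero => rfl
  | succ t ih =>
    rw [alignedDir, norm_smul, LinearIsometryEquiv.norm_map, ih]
    split_ifs <;> simp

/-- The noise `ν` with all terms from time `s` on replaced by the extreme aligned noise
of sign `σ`. -/
def pushFrom (lam : ℝ) (A : Euc n ≃ₗᵢ[ℝ] Euc n) (a : ℕ → ℝ) (u : Euc n) (ν : ℕ → Euc n)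
    (s : ℕ) (σ : ℝ) (i : ℕ) : Euc n :=
  if i < s then ν i else (σ * a i) • alignedDir lam A u i

lemma pushFrom_mem_noise {lam : ℝ} {A : Euc n ≃ₗᵢ[ℝ] Euc n} {T : ℕ} {a : ℕ → ℝ}
    (ha : ∀ t, 0 ≤ a t) {u : Euc n} (hu : ‖u‖ = 1) {ν : ℕ → Euc n} (hν : ν ∈ Noise n T a)
    (s : ℕ) {σ : ℝ} (hσ : |σ| = 1) : pushFrom lam A a u ν s σ ∈ Noise n T a := by
  intro t ht
  unfold pushFrom
  split_ifs
  · exact hν t ht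
  · rw [norm_smul, norm_alignedDir, hu, Real.norm_eq_abs, abs_mul, hσ, abs_of_nonneg (ha t)]
    simp

lemma srcX_pushFrom_of_lt (lam : ℝ) (A : Euc n ≃ₗᵢ[ℝ] Euc n) (a : ℕ → ℝ) (u : Euc n)
    (ν : ℕ → Euc n) {s i : ℕ} (σ : ℝ) (hi : i < s) :
    srcX lam A (pushFrom lam A a u ν s σ) i = srcX lam A ν i :=
  srcX_congr lam A fun _ hj => if_pos (hj.trans_lt hi)

lemma predX_pushFrom_self (lam : ℝ) (A : Euc n ≃ₗᵢ[ℝ] Euc n) (a : ℕ → ℝ) (u : Euc n)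
    (ν : ℕ → Euc n) (s : ℕ) (σ : ℝ) :
    predX lam A (pushFrom lam A a u ν s σ) s = predX lam A ν s := by
  cases s with
  | zero => rfl
  | succ s => simp only [predX, srcX_pushFrom_of_lt lam A a u ν σ (Nat.lt_succ_self s)]

/-- Number of transmissions before time `t`. -/
def TxStrategy.count {lam : ℝ} {A : Euc n ≃ₗᵢ[ℝ] Euc n} {T K : ℕ} (f : TxStrategy lam A T K)
    (ν : ℕ → Euc n) (t : ℕ) : ℕ :=
  ∑ i ∈ Finset.range t, if f.U ν i then 1 else 0

lemma TxStrategy.count_le {lam : ℝ} {A : Euc n ≃ₗᵢ[ℝ] Euc n} {T K : ℕ}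
    (f : TxStrategy lam A T K) (ν : ℕ → Euc n) {t : ℕ} (ht : t ≤ T) : f.count ν t ≤ K := by
  induction t with
  | zero => simp [count]
  | succ t ih =>
    have h1 := ih (by omega)
    have h2 := f.energy_ok ν t ht
    unfold count at h1 ⊢
    rw [Finset.sum_range_succ]
    split_ifs with h
    · exact h2 h
    · simpa using h1

lemma TxStrategy.count_lt_count {lam : ℝ} {A : Euc n ≃ₗᵢ[ℝ] Euc n} {T K : ℕ}
    (f : TxStrategy lam A T K) (ν : ℕ → Euc n) {s i t : ℕ} (hsi : s ≤ i) (hit : i < t)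
    (hU : f.U ν i = true) : f.count ν s < f.count ν t := by
  refine Finset.sum_lt_sum_of_subset (i := i) (Finset.range_mono (by omega))
    (by simpa using hit) (by simpa using hsi) (by simp [hU]) (by simp)

lemma TxStrategy.count_congr {lam : ℝ} {A : Euc n ≃ₗᵢ[ℝ] Euc n} {T K : ℕ}
    (f : TxStrategy lam A T K) {ν ν' : ℕ → Euc n} {s : ℕ} (hs : s ≤ T)
    (h : ∀ i < s, srcX lam A ν i = srcX lam A ν' i) : f.count ν s = f.count ν' s := by
  refine Finset.sum_congr rfl fun i hi => ?_
  have hi' := Finset.mem_range.mp hi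
  rw [f.adapted ν ν' i (by omega) fun j hj => h j (by omega)]

lemma norm_srcX_sub_srcX_le {lam : ℝ} {A : Euc n ≃ₗᵢ[ℝ] Euc n} {T K : ℕ} {a : ℕ → ℝ}
    {f : TxStrategy lam A T K} {g : EstStrategy n} {c : ℝ} (hc : 0 ≤ c)
    (hJ : Jcost lam A T K a f g ≤ ENNReal.ofReal c) {ν ν' : ℕ → Euc n}
    (hν : ν ∈ Noise n T a) (hν' : ν' ∈ Noise n T a) {t : ℕ} (ht : t < T)
    (hY : ∀ i ≤ t, chOut lam A f.U ν i = chOut lam A f.U ν' i) :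
    ‖srcX lam A ν t - srcX lam A ν' t‖ ≤ 2 * c := by
  have key : ∀ μ ∈ Noise n T a,
      ‖srcX lam A μ t - g t (fun i => chOut lam A f.U μ i)‖ ≤ c := fun μ hμ =>
    (ENNReal.ofReal_le_ofReal_iff hc).mp <| le_trans
      (le_iSup₂_of_le μ hμ (le_iSup (fun t : Fin T => ENNReal.ofReal
        ‖srcX lam A μ t - g t (fun i => chOut lam A f.U μ i)‖) ⟨t, ht⟩)) hJ
  have h1 := key ν hν
  have h2 := key ν' hν'
  have hg : (fun i : Fin (t + 1) => chOut lam A f.U ν i) =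
      fun i : Fin (t + 1) => chOut lam A f.U ν' i :=
    funext fun i => hY i (Nat.lt_succ_iff.mp i.2)
  rw [hg] at h1
  rw [← sub_sub_sub_cancel_right _ _ (g t fun i : Fin (t + 1) => chOut lam A f.U ν' i)]
  exact (norm_sub_le _ _).trans (by linarith)

/-- Against a pair of cost at most `c`, the adversary can force as many transmissions as
there are resets of the worst-case run. -/
lemma exists_noise_count_ge {lam : ℝ} {A : Euc n ≃ₗᵢ[ℝ] Euc n} {T K : ℕ} {a : ℕ → ℝ}
    (ha : ∀ t, 0 ≤ a t) {u : Euc n} (hu : ‖u‖ = 1)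
    {f : TxStrategy lam A T K} {g : EstStrategy n} {c : ℝ} (hc : 0 ≤ c)
    (hJ : Jcost lam A T K a f g ≤ ENNReal.ofReal c) {t : ℕ} (ht : t ≤ T) :
    ∃ s ≤ t, ∃ ν ∈ Noise n T a, (worstRun lam c a t).2 ≤ f.count ν s ∧
      predX lam A (pushFrom lam A a u ν s 1) t - predX lam A (pushFrom lam A a u ν s (-1)) t =
        (2 * (|lam| * (worstRun lam c a t).1)) • alignedDir lam A u t := by
  induction t with
  | zero => exact ⟨0, le_rfl, 0, fun t _ => by simpa using ha t, by simp [worstRun],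
      by simp [worstRun, predX]⟩
  | succ t ih =>
    obtain ⟨s, hst, ν, hν, hcount, hpred⟩ := ih (by omega)
    have hsrc : srcX lam A (pushFrom lam A a u ν s 1) t -
        srcX lam A (pushFrom lam A a u ν s (-1)) t =
        (2 * (|lam| * (worstRun lam c a t).1 + a t)) • alignedDir lam A u t := by
      rw [srcX_eq_predX_add, srcX_eq_predX_add, add_sub_add_comm, hpred]
      simp only [pushFrom, if_neg (not_lt.mpr hst)]
      module
    by_cases hgt : c < |lam| * (worstRun lam c a t).1 + a t
    · have hp := pushFrom_mem_noise (lam := lam) (A := A) ha hu hν s (σ := 1) (by simp)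
      have hm := pushFrom_mem_noise (lam := lam) (A := A) ha hu hν s (σ := -1) (by simp)
      have hforce : ∃ σ : ℝ, pushFrom lam A a u ν s σ ∈ Noise n T a ∧
          ∃ i, s ≤ i ∧ i ≤ t ∧ f.U (pushFrom lam A a u ν s σ) i = true := by
        by_contra! hno
        have hle := norm_srcX_sub_srcX_le hc hJ hp hm ht fun i hi => by
          unfold chOut
          by_cases his : i < s
          · have hx : ∀ j ≤ i, srcX lam A (pushFrom lam A a u ν s 1) j =
                srcX lam A (pushFrom lam A a u ν s (-1)) j := fun j hj => by
              rw [srcX_pushFrom_of_lt _ _ _ _ _ _ (hj.trans_lt his),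
                srcX_pushFrom_of_lt _ _ _ _ _ _ (hj.trans_lt his)]
            rw [hx i le_rfl, f.adapted _ _ i (by omega) hx]
          · rw [if_neg (hno 1 hp i (not_lt.mp his) hi),
              if_neg (hno (-1) hm i (not_lt.mp his) hi)]
        rw [hsrc, norm_smul, norm_alignedDir, hu, mul_one, Real.norm_eq_abs] at hle
        linarith [le_abs_self (2 * (|lam| * (worstRun lam c a t).1 + a t))]
      obtain ⟨σ, hσ, i, hsi, hit, hU⟩ := hforce
      refine ⟨t + 1, le_rfl, pushFrom lam A a u ν s σ, hσ, ?_, ?_⟩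
      · have h1 := f.count_lt_count _ hsi (Nat.lt_add_one_of_le hit) hU
        rw [f.count_congr (by omega) fun j hj =>
          srcX_pushFrom_of_lt lam A a u ν σ hj] at h1
        simp only [worstRun, if_pos hgt]
        omega
      · rw [predX_pushFrom_self, predX_pushFrom_self]
        simp [worstRun, hgt]
    · refine ⟨s, by omega, ν, hν, by simpa [worstRun, hgt] using hcount, ?_⟩
      simp only [predX, worstRun, if_neg hgt]
      rw [← smul_sub, ← map_sub, hsrc, map_smul, smul_comm, smul_map_alignedDir, smul_smul]
      congr 1
      ring

lemma worstRun_snd_le_of_Jcost_le (hn : 1 ≤ n) {lam : ℝ} {A : Euc n ≃ₗᵢ[ℝ] Euc n} {T K : ℕ}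
    {a : ℕ → ℝ} (ha : ∀ t, 0 ≤ a t) {f : TxStrategy lam A T K} {g : EstStrategy n} {c : ℝ}
    (hc : 0 ≤ c) (hJ : Jcost lam A T K a f g ≤ ENNReal.ofReal c) :
    (worstRun lam c a T).2 ≤ K := by
  have hu : ‖(EuclideanSpace.single ⟨0, hn⟩ 1 : Euc n)‖ = 1 := by simp
  obtain ⟨s, hs, ν, -, hcount, -⟩ := exists_noise_count_ge ha hu hc hJ le_rfl
  exact hcount.trans (f.count_le ν hs)

/-- the Kalman-like estimator `g*` is part of a globally optimal pair. -/
theorem stmt14 {n : ℕ} (hn : 1 ≤ n) (lam : ℝ) (A : Euc n ≃ₗᵢ[ℝ] Euc n)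
    (T K : ℕ) (hT : 1 ≤ T) (hK : 1 ≤ K) (hKT : K < T)
    (a : ℕ → ℝ) (ha : ∀ t, 0 ≤ a t) :
    (⨅ f : TxStrategy lam A T K, Jcost lam A T K a f (gstar lam A)) =
      ⨅ (f : TxStrategy lam A T K) (g : EstStrategy n), Jcost lam A T K a f g := by
  refine le_antisymm (le_iInf₂ fun f g => ?_) (iInf_mono fun f => iInf_le _ (gstar lam A))
  by_cases hJ : Jcost lam A T K a f g = ⊤
  · simp [hJ]
  · have hof : ENNReal.ofReal (Jcost lam A T K a f g).toReal = Jcost lam A T K a f g :=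
      ENNReal.ofReal_toReal hJ
    have hc : 0 ≤ (Jcost lam A T K a f g).toReal := ENNReal.toReal_nonneg
    exact iInf_le_of_le (thresholdStrategy lam A T K (Jcost lam A T K a f g).toReal) <|
      (Jcost_thresholdStrategy_le ha hc (worstRun_snd_le_of_Jcost_le hn ha hc hof.ge)).trans
        hof.le
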